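/- There exist constants C4, C7, C8 > 0 and a natural number n0 such that for all integers n ≥ n0 with k ≤ n the following holds. Let p = (p_1,…,p_k) satisfy p_1 ≥ p_2 ≥ … ≥ p_k, p_1 ≥ C7·(log n)/n, and h·p_1 ≥ C4·log n, and let j ∈ {2,…,k} satisfy C8·√(p_1/n) ≤ p_1 − p_j ≤ √(2·(p_1 + p_2)/h). Let conf' be a random configuration that is multinomially distributed with parameters n and the winning-probability vector (w_1(p),…,w_k(p)) of the h-majority rule with uniform tie-breaking. Then with probability at least 1 − 1/n⁴ one has conf'(1)/n − conf'(j)/n ≥ e · (p_1 − p_j). -/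

import Mathlib

open scoped BigOperators

noncomputable section

/-- The number of the `h` i.i.d. samples `ω` that are equal to opinion `i`. -/
def cnt {k h : ℕ} (ω : Fin h → Fin k) (i : Fin k) : ℕ :=
  (Finset.univ.filter fun j => ω j = i).card

/-- The probability of the event `A` under `h` i.i.d. samples drawn from the
probability vector `p` on `Fin k` (multinomial sampling). -/
def multiPr (k h : ℕ) (p : Fin k → ℝ) (A : Set (Fin h → Fin k)) : ℝ :=
  ∑ ω : Fin h → Fin k, A.indicator (fun ω => ∏ j, p (ω j)) ω

/-- The maximal number of samples received by an opinion. -/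
def maxCnt {k h : ℕ} (ω : Fin h → Fin k) : ℕ :=
  Finset.univ.sup (cnt ω)

/-- The number of opinions achieving the maximal number of samples. -/
def numMax {k h : ℕ} (ω : Fin h → Fin k) : ℕ :=
  (Finset.univ.filter fun i => cnt ω i = maxCnt ω).card

/-- The probability that opinion `i` wins the `h`-majority with uniform
tie-breaking, jointly with the event `A`:
`E[ 1_A · 1{X_i = max_l X_l} / #{l : X_l maximal} ]`. -/
def winPrOn (k h : ℕ) (p : Fin k → ℝ) (A : Set (Fin h → Fin k)) (i : Fin k) : ℝ :=
  ∑ ω : Fin h → Fin k,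
    (A ∩ {ω' | cnt ω' i = maxCnt ω'}).indicator
      (fun ω => (∏ j, p (ω j)) / (numMax ω : ℝ)) ω

/-- The probability that opinion `i` wins the `h`-majority with uniform tie-breaking. -/
def winPr (k h : ℕ) (p : Fin k → ℝ) (i : Fin k) : ℝ :=
  winPrOn k h p Set.univ i

/-- `W_{i,strict}`: opinion `i` is the unique most sampled opinion. -/
def Wstrict (k h : ℕ) (i : Fin k) : Set (Fin h → Fin k) :=
  {ω | ∀ j, j ≠ i → cnt ω j < cnt ω i}

/-- `W_{i,ties}`: opinion `i` is among the most sampled opinions. -/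
def Wties (k h : ℕ) (i : Fin k) : Set (Fin h → Fin k) :=
  {ω | ∀ j, j ≠ i → cnt ω j ≤ cnt ω i}

/-- `W_{1,2,strict}`: opinion `i₁` or opinion `i₂` is the unique most sampled opinion. -/
def W12strict (k h : ℕ) (i₁ i₂ : Fin k) : Set (Fin h → Fin k) :=
  Wstrict k h i₁ ∪ Wstrict k h i₂

/-- Opinion 1 (as an element of `Fin k`, assuming `2 ≤ k`). -/
def o₁ (k : ℕ) (hk : 2 ≤ k) : Fin k := ⟨0, by omega⟩

/-- Opinion 2 (as an element of `Fin k`, assuming `2 ≤ k`). -/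
def o₂ (k : ℕ) (hk : 2 ≤ k) : Fin k := ⟨1, by omega⟩

/-- The share of the win that opinion `i` receives when the samples are `ω`. -/
def winWeight {k h : ℕ} (ω : Fin h → Fin k) (i : Fin k) : ℝ :=
  if cnt ω i = maxCnt ω then 1 / (numMax ω : ℝ) else 0

theorem winPr_eq_sum {k h : ℕ} (p : Fin k → ℝ) (i : Fin k) :
    winPr k h p i = ∑ ω : Fin h → Fin k, (∏ t, p (ω t)) * winWeight ω i := by
  unfold winPr winPrOn
  refine Finset.sum_congr rfl fun ω _ => ?_
  by_cases hi : cnt ω i = maxCnt ω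
  · simp [winWeight, hi, div_eq_mul_inv]
  · simp [winWeight, hi]

theorem cnt_le_maxCnt {k h : ℕ} (ω : Fin h → Fin k) (i : Fin k) : cnt ω i ≤ maxCnt ω :=
  Finset.le_sup (f := cnt ω) (Finset.mem_univ i)

theorem exists_cnt_eq_maxCnt {k h : ℕ} (hk : 0 < k) (ω : Fin h → Fin k) :
    ∃ i, cnt ω i = maxCnt ω := by
  have : (Finset.univ : Finset (Fin k)).Nonempty := ⟨⟨0, hk⟩, Finset.mem_univ _⟩
  obtain ⟨i, -, hi⟩ := Finset.exists_mem_eq_sup _ this (cnt ω)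
  exact ⟨i, hi.symm⟩

theorem numMax_pos {k h : ℕ} (hk : 0 < k) (ω : Fin h → Fin k) : 0 < numMax ω := by
  obtain ⟨i, hi⟩ := exists_cnt_eq_maxCnt hk ω
  exact Finset.card_pos.2 ⟨i, by simp [hi]⟩

theorem winWeight_nonneg {k h : ℕ} (ω : Fin h → Fin k) (i : Fin k) : 0 ≤ winWeight ω i := by
  unfold winWeight; positivity

theorem sum_winWeight {k h : ℕ} (hk : 0 < k) (ω : Fin h → Fin k) :
    ∑ i, winWeight ω i = 1 := by
  unfold winWeight
  rw [← Finset.sum_filter, Finset.sum_const, nsmul_eq_mul]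
  have : (numMax ω : ℝ) ≠ 0 := by exact_mod_cast (numMax_pos hk ω).ne'
  exact mul_one_div_cancel this

theorem winWeight_le_one {k h : ℕ} (ω : Fin h → Fin k) (i : Fin k) : winWeight ω i ≤ 1 := by
  rw [← sum_winWeight i.pos ω]
  exact Finset.single_le_sum (fun i _ => winWeight_nonneg ω i) (Finset.mem_univ i)

theorem winWeight_add_le_one {k h : ℕ} {a b : Fin k} (hab : a ≠ b) (ω : Fin h → Fin k) :
    winWeight ω a + winWeight ω b ≤ 1 := by
  rw [← sum_winWeight a.pos ω, ← Finset.sum_pair hab]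
  exact Finset.sum_le_sum_of_subset_of_nonneg (Finset.subset_univ _)
    fun i _ _ => winWeight_nonneg ω i

theorem winWeight_eq_zero_of_lt {k h : ℕ} {ω : Fin h → Fin k} {i j : Fin k}
    (hij : cnt ω i < cnt ω j) : winWeight ω i = 0 :=
  if_neg (hij.trans_le (cnt_le_maxCnt ω j)).ne

theorem winWeight_eq_of_cnt_eq {k h : ℕ} {ω : Fin h → Fin k} {i j : Fin k}
    (hij : cnt ω i = cnt ω j) : winWeight ω i = winWeight ω j := by
  simp [winWeight, hij]

theorem sum_prod_mul_prod {k h : ℕ} (p f : Fin k → ℝ) :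
    ∑ ω : Fin h → Fin k, (∏ t, p (ω t)) * ∏ t, f (ω t) = (∑ i, p i * f i) ^ h := by
  simp_rw [← Finset.prod_mul_distrib]
  rw [← Fintype.card_fin h, ← Fintype.piFinset_univ, Fintype.card_fin]
  rw [← Finset.prod_univ_sum (fun _ => Finset.univ) (fun (_ : Fin h) i => p i * f i)]
  simp

theorem sum_prod_eq_one {k h : ℕ} {p : Fin k → ℝ} (hp1 : ∑ i, p i = 1) :
    ∑ ω : Fin h → Fin k, ∏ t, p (ω t) = 1 := by
  have := sum_prod_mul_prod (h := h) p (fun _ => 1)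
  simpa [hp1] using this

theorem winPr_nonneg {k h : ℕ} {p : Fin k → ℝ} (hp : ∀ i, 0 ≤ p i) (i : Fin k) :
    0 ≤ winPr k h p i := by
  rw [winPr_eq_sum]
  exact Finset.sum_nonneg fun ω _ =>
    mul_nonneg (Finset.prod_nonneg fun t _ => hp _) (winWeight_nonneg ω i)

theorem sum_winPr {k h : ℕ} (hk : 0 < k) {p : Fin k → ℝ} (hp1 : ∑ i, p i = 1) :
    ∑ i, winPr k h p i = 1 := by
  simp_rw [winPr_eq_sum]
  rw [Finset.sum_comm]
  simp_rw [← Finset.mul_sum, sum_winWeight hk, mul_one]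
  exact sum_prod_eq_one hp1

/-- The Chernoff bound for the product measure on samples. -/
theorem multiPr_le_pow {k h : ℕ} {p : Fin k → ℝ} (hp : ∀ i, 0 ≤ p i) (f : Fin k → ℝ)
    (hf : ∀ i, 0 ≤ f i) {c : ℝ} (A : Set (Fin h → Fin k))
    (hA : ∀ ω ∈ A, c ≤ ∏ t, f (ω t)) :
    c * multiPr k h p A ≤ (∑ i, p i * f i) ^ h := by
  rw [← sum_prod_mul_prod, multiPr, Finset.mul_sum]
  refine Finset.sum_le_sum fun ω _ => ?_
  have hP : 0 ≤ ∏ t, p (ω t) := Finset.prod_nonneg fun t _ => hp _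
  by_cases hω : ω ∈ A
  · rw [Set.indicator_of_mem hω, mul_comm]
    exact mul_le_mul_of_nonneg_left (hA ω hω) hP
  · rw [Set.indicator_of_notMem hω, mul_zero]
    exact mul_nonneg hP (Finset.prod_nonneg fun t _ => hf _)

/-- A sample equal to `a` has sign `1`, a sample equal to `b` has sign `-1`. -/
def pairSign {k : ℕ} (a b i : Fin k) : ℝ :=
  (if i = a then 1 else 0) - (if i = b then 1 else 0)

/-- The lead of `a` over `b` in the samples `ω`. -/
def lead {k h : ℕ} (a b : Fin k) (ω : Fin h → Fin k) : ℝ := ∑ t, pairSign a b (ω t)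

theorem sum_ite_eq_cnt {k h : ℕ} (ω : Fin h → Fin k) (i : Fin k) :
    ∑ t, (if ω t = i then (1 : ℝ) else 0) = cnt ω i := by
  simp [cnt]

theorem lead_eq {k h : ℕ} (a b : Fin k) (ω : Fin h → Fin k) :
    lead a b ω = cnt ω a - cnt ω b := by
  simp only [lead, pairSign, Finset.sum_sub_distrib, sum_ite_eq_cnt]

theorem pairSign_swap {k : ℕ} (a b i : Fin k) :
    pairSign a b (Equiv.swap a b i) = - pairSign a b i := by
  unfold pairSign
  rcases eq_or_ne a b with rfl | hab
  · simp
  · rcases eq_or_ne i a with rfl | hia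
    · simp [hab, hab.symm]
    · rcases eq_or_ne i b with rfl | hib
      · simp [hab, hab.symm]
      · simp [Equiv.swap_apply_of_ne_of_ne hia hib, hia, hib]

/-- Swap the opinions `a` and `b` in the samples selected by `ε`. -/
def swapOn {k h : ℕ} (a b : Fin k) (ε : Fin h → Bool) (ω : Fin h → Fin k) : Fin h → Fin k :=
  fun t => if ε t then Equiv.swap a b (ω t) else ω t

theorem swapOn_involutive {k h : ℕ} (a b : Fin k) (ε : Fin h → Bool) :
    Function.Involutive (swapOn a b ε) := by
  intro ω
  funext t
  by_cases ht : ε t <;> simp [swapOn, ht]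

theorem sum_swapOn {k h : ℕ} (a b : Fin k) (ε : Fin h → Bool) (φ : (Fin h → Fin k) → ℝ) :
    ∑ ω, φ (swapOn a b ε ω) = ∑ ω, φ ω :=
  Equiv.sum_comp (swapOn_involutive a b ε).toPerm φ

/-- The sign attached to a Boolean. -/
def boolSign (e : Bool) : ℝ := if e then -1 else 1

theorem lead_swapOn {k h : ℕ} (a b : Fin k) (ε : Fin h → Bool) (ω : Fin h → Fin k) :
    lead a b (swapOn a b ε ω) = ∑ t, boolSign (ε t) * pairSign a b (ω t) := by
  refine Finset.sum_congr rfl fun t _ => ?_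
  by_cases ht : ε t <;> simp [swapOn, ht, boolSign, pairSign_swap]

theorem cnt_swapOn_of_ne {k h : ℕ} {a b i : Fin k} (ha : i ≠ a) (hb : i ≠ b)
    (ε : Fin h → Bool) (ω : Fin h → Fin k) : cnt (swapOn a b ε ω) i = cnt ω i := by
  unfold cnt
  congr 1
  refine Finset.filter_congr fun t _ => ?_
  by_cases ht : ε t
  · simp [swapOn, ht, Equiv.swap_apply_eq_iff, Equiv.swap_apply_of_ne_of_ne ha hb]
  · simp [swapOn, ht]

theorem pairSign_sq {k : ℕ} {a b : Fin k} (hab : a ≠ b) (i : Fin k) :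
    pairSign a b i ^ 2 = (if i = a then 1 else 0) + (if i = b then 1 else 0) := by
  unfold pairSign
  rcases eq_or_ne i a with rfl | hia
  · simp [hab]
  · by_cases hib : i = b
    · simp [hib, hab.symm]
    · simp [hia, hib]

theorem sum_pairSign_sq {k h : ℕ} {a b : Fin k} (hab : a ≠ b) (ω : Fin h → Fin k) :
    ∑ t, pairSign a b (ω t) ^ 2 = cnt ω a + cnt ω b := by
  simp only [pairSign_sq hab, Finset.sum_add_distrib, sum_ite_eq_cnt]

theorem cnt_add_cnt_swapOn {k h : ℕ} {a b : Fin k} (hab : a ≠ b) (ε : Fin h → Bool)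
    (ω : Fin h → Fin k) :
    cnt (swapOn a b ε ω) a + cnt (swapOn a b ε ω) b = cnt ω a + cnt ω b := by
  have : ((cnt (swapOn a b ε ω) a + cnt (swapOn a b ε ω) b : ℕ) : ℝ) =
      ((cnt ω a + cnt ω b : ℕ) : ℝ) := by
    push_cast
    rw [← sum_pairSign_sq hab, ← sum_pairSign_sq hab]
    refine Finset.sum_congr rfl fun t _ => ?_
    by_cases ht : ε t <;> simp [swapOn, ht, pairSign_swap]
  exact_mod_cast this

/-- The probability that one of two opinions wins increases with the modulus of the lead
when the other counts and the joint count of the two opinions are fixed. -/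
theorem winWeight_add_mono {k h : ℕ} {a b : Fin k} (hab : a ≠ b) {ω ω' : Fin h → Fin k}
    (hne : ∀ i, i ≠ a → i ≠ b → cnt ω' i = cnt ω i)
    (hadd : cnt ω' a + cnt ω' b = cnt ω a + cnt ω b)
    (hlt : |lead a b ω| < |lead a b ω'|) :
    winWeight ω a + winWeight ω b ≤ winWeight ω' a + winWeight ω' b := by
  have hlt' : |((cnt ω a : ℤ) - cnt ω b)| < |((cnt ω' a : ℤ) - cnt ω' b)| := by
    rw [lead_eq, lead_eq] at hlt
    exact_mod_cast hlt
  by_cases hwin : cnt ω a = maxCnt ω ∨ cnt ω b = maxCnt ω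
  · refine (winWeight_add_le_one hab ω).trans ?_
    rw [← sum_winWeight a.pos ω', ← Finset.sum_pair hab]
    refine (Finset.sum_subset (Finset.subset_univ _) fun i _ hi => ?_).ge
    simp only [Finset.mem_insert, Finset.mem_singleton, not_or] at hi
    have h1 := cnt_le_maxCnt ω a
    have h2 := cnt_le_maxCnt ω b
    have h3 := cnt_le_maxCnt ω i
    have h4 := hne i hi.1 hi.2
    by_cases h5 : cnt ω' i < cnt ω' a
    · exact winWeight_eq_zero_of_lt h5
    · refine winWeight_eq_zero_of_lt (j := b) ?_
      rcases abs_cases ((cnt ω a : ℤ) - cnt ω b) with h6 | h6 <;>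
      rcases abs_cases ((cnt ω' a : ℤ) - cnt ω' b) with h7 | h7 <;> omega
  · rw [not_or] at hwin
    have : winWeight ω a + winWeight ω b = 0 := by simp [winWeight, hwin]
    rw [this]
    exact add_nonneg (winWeight_nonneg _ _) (winWeight_nonneg _ _)

theorem sum_boolSign_moments {h : ℕ} (c : Fin h → ℝ) :
    ∑ ε : Fin h → Bool, (∑ t, boolSign (ε t) * c t) ^ 2 = 2 ^ h * ∑ t, c t ^ 2 ∧
    ∑ ε : Fin h → Bool, (∑ t, boolSign (ε t) * c t) ^ 4 ≤ 2 ^ h * (3 * (∑ t, c t ^ 2) ^ 2) := by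
  induction h with
  | zero => simp
  | succ h ih =>
    obtain ⟨ih2, ih4⟩ := ih (fun t => c t.succ)
    have key : ∀ F : (Fin (h + 1) → Bool) → ℝ, ∑ ε, F ε =
        ∑ ε : Fin h → Bool, (F (Fin.cons true ε) + F (Fin.cons false ε)) := by
      intro F
      rw [← (Fin.consEquiv fun _ => Bool).sum_comp F, Fintype.sum_prod_type, Fintype.sum_bool,
        Finset.sum_add_distrib]
      rfl
    rw [key, key]
    simp only [Fin.sum_univ_succ, Fin.cons_zero, Fin.cons_succ]
    set A := ∑ t : Fin h, c t.succ ^ 2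
    have hA : 0 ≤ A := Finset.sum_nonneg fun _ _ => sq_nonneg _
    constructor
    · have : ∀ ε : Fin h → Bool,
          (boolSign true * c 0 + ∑ t, boolSign (ε t) * c t.succ) ^ 2 +
          (boolSign false * c 0 + ∑ t, boolSign (ε t) * c t.succ) ^ 2 =
          2 * c 0 ^ 2 + 2 * (∑ t, boolSign (ε t) * c t.succ) ^ 2 := by
        intro ε; simp only [boolSign]; simp; ring
      simp only [this, Finset.sum_add_distrib, ← Finset.mul_sum, ih2]
      simp
      ring
    · have : ∀ ε : Fin h → Bool,
          (boolSign true * c 0 + ∑ t, boolSign (ε t) * c t.succ) ^ 4 +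
          (boolSign false * c 0 + ∑ t, boolSign (ε t) * c t.succ) ^ 4 =
          2 * c 0 ^ 4 + 12 * c 0 ^ 2 * (∑ t, boolSign (ε t) * c t.succ) ^ 2
            + 2 * (∑ t, boolSign (ε t) * c t.succ) ^ 4 := by
        intro ε; simp only [boolSign]; simp; ring
      simp only [this, Finset.sum_add_distrib, ← Finset.mul_sum, ih2]
      simp
      have h2 : (0 : ℝ) < 2 ^ h := by positivity
      have h3 : 0 ≤ 2 ^ h * c 0 ^ 4 := by positivity
      rw [pow_succ]
      linear_combination 2 * ih4 + 4 * h3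

theorem le_sum_min_one_abs {h : ℕ} (c : Fin h → ℝ) {x m : ℝ} (hx : 0 ≤ x) (hm : 0 < m)
    (hmc : m ≤ ∑ t, c t ^ 2) :
    2 ^ h * (min 1 (x * √(3 / 2 * m)) / 3) ≤
      ∑ ε : Fin h → Bool, min 1 (x * |∑ t, boolSign (ε t) * c t|) := by
  obtain ⟨h2, h4⟩ := sum_boolSign_moments c
  set A := ∑ t, c t ^ 2
  have hA : 0 < A := hm.trans_le hmc
  set y := min 1 (x * √(3 / 2 * m)) with hy
  have hy0 : 0 ≤ y := by positivity
  have hpt : ∀ D : ℝ, y * (D ^ 2 / (3 / 2 * A) - D ^ 4 / (3 / 2 * A) ^ 2 / 4) ≤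
      min 1 (x * |D|) := by
    intro D
    set s := √(3 / 2 * A) with hs
    have hs0 : 0 < s := by positivity
    have hs2 : s ^ 2 = 3 / 2 * A := Real.sq_sqrt (by positivity)
    have hyx : y ≤ x * s := (min_le_right _ _).trans (by rw [hs]; gcongr)
    have hy1 : y ≤ 1 := min_le_left _ _
    set u := |D| / s with hu
    have hu0 : 0 ≤ u := by positivity
    have hD : |D| = u * s := by rw [hu]; field_simp
    have e2 : D ^ 2 / (3 / 2 * A) = u ^ 2 := by
      rw [← sq_abs, hD, ← hs2]; field_simp
    have e4 : D ^ 4 / (3 / 2 * A) ^ 2 = u ^ 4 := by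
      rw [← Even.pow_abs (by decide : Even 4) D, hD, ← hs2]; field_simp
    rw [e2, e4, hD]
    refine le_min ?_ ?_
    · nlinarith [sq_nonneg (u ^ 2 - 2)]
    · have h5 : u ^ 2 - u ^ 4 / 4 ≤ u := by
        rcases le_total u 1 with h | h
        · nlinarith [pow_nonneg hu0 4]
        · nlinarith [sq_nonneg (u ^ 2 - 2)]
      calc y * (u ^ 2 - u ^ 4 / 4) ≤ y * u := by gcongr
        _ ≤ x * s * u := by gcongr
        _ = x * (u * s) := by ring
  refine le_trans ?_ (Finset.sum_le_sum fun ε _ => hpt _)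
  rw [← Finset.mul_sum, Finset.sum_sub_distrib, ← Finset.sum_div, ← Finset.sum_div,
    ← Finset.sum_div, h2]
  have h5 : (∑ ε : Fin h → Bool, (∑ t, boolSign (ε t) * c t) ^ 4) / (3 / 2 * A) ^ 2 / 4 ≤
      2 ^ h * (3 * A ^ 2) / (3 / 2 * A) ^ 2 / 4 := by gcongr
  have h6 : (2 : ℝ) ^ h * (3 * A ^ 2) / (3 / 2 * A) ^ 2 / 4 = 2 ^ h / 3 := by
    field_simp; norm_num
  have h7 : (2 : ℝ) ^ h * A / (3 / 2 * A) = 2 ^ h * (2 / 3) := by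
    field_simp
  calc (2 : ℝ) ^ h * (y / 3) = y * (2 ^ h * (2 / 3) - 2 ^ h / 3) := by ring
    _ ≤ _ := by
      rw [h7]
      exact mul_le_mul_of_nonneg_left (by linarith) hy0

theorem cnt_swapOn_true {k h : ℕ} (a b i : Fin k) (ω : Fin h → Fin k) :
    cnt (swapOn a b (fun _ => true) ω) i = cnt ω (Equiv.swap a b i) := by
  simp [cnt, swapOn, Equiv.swap_apply_eq_iff]

theorem maxCnt_swapOn_true {k h : ℕ} (a b : Fin k) (ω : Fin h → Fin k) :
    maxCnt (swapOn a b (fun _ => true) ω) = maxCnt ω := by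
  refine le_antisymm (Finset.sup_le fun i _ => ?_) (Finset.sup_le fun i _ => ?_)
  · rw [cnt_swapOn_true]
    exact cnt_le_maxCnt _ _
  · rw [← Equiv.swap_apply_self a b i, ← cnt_swapOn_true]
    exact cnt_le_maxCnt _ _

theorem numMax_swapOn_true {k h : ℕ} (a b : Fin k) (ω : Fin h → Fin k) :
    numMax (swapOn a b (fun _ => true) ω) = numMax ω := by
  unfold numMax
  refine Finset.card_bij (fun i _ => Equiv.swap a b i) ?_ ?_ ?_
  · intro i hi
    simpa [cnt_swapOn_true, maxCnt_swapOn_true] using hi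
  · intro i _ j _ hij
    exact (Equiv.swap a b).injective hij
  · intro i hi
    exact ⟨Equiv.swap a b i, by simpa [cnt_swapOn_true, maxCnt_swapOn_true] using hi, by simp⟩

theorem winWeight_swapOn_true {k h : ℕ} (a b i : Fin k) (ω : Fin h → Fin k) :
    winWeight (swapOn a b (fun _ => true) ω) i = winWeight ω (Equiv.swap a b i) := by
  simp [winWeight, cnt_swapOn_true, maxCnt_swapOn_true, numMax_swapOn_true]

theorem lead_swapOn_true {k h : ℕ} (a b : Fin k) (ω : Fin h → Fin k) :
    lead a b (swapOn a b (fun _ => true) ω) = - lead a b ω := by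
  simp [lead_eq, cnt_swapOn_true]

theorem sum_symm_mul_swapOn {k h : ℕ} {q : Fin k → ℝ} {a b : Fin k}
    (hq : ∀ i, q (Equiv.swap a b i) = q i) (ε : Fin h → Bool) (φ : (Fin h → Fin k) → ℝ) :
    ∑ ω, (∏ t, q (ω t)) * φ (swapOn a b ε ω) = ∑ ω, (∏ t, q (ω t)) * φ ω := by
  rw [← sum_swapOn a b ε]
  refine Finset.sum_congr rfl fun ω _ => ?_
  rw [swapOn_involutive a b ε ω]
  congr 1
  refine Finset.prod_congr rfl fun t _ => ?_
  by_cases ht : ε t <;> simp [swapOn, ht, hq]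

theorem sum_symm_mul_average {k h : ℕ} {q : Fin k → ℝ} {a b : Fin k}
    (hq : ∀ i, q (Equiv.swap a b i) = q i) (φ : (Fin h → Fin k) → ℝ) :
    ∑ ω, (∏ t, q (ω t)) * ∑ ε : Fin h → Bool, φ (swapOn a b ε ω) =
      2 ^ h * ∑ ω, (∏ t, q (ω t)) * φ ω := by
  simp_rw [Finset.mul_sum]
  rw [Finset.sum_comm]
  simp_rw [sum_symm_mul_swapOn hq]
  simp [Finset.mul_sum]

theorem prod_tilt {k h : ℕ} {p q : Fin k → ℝ} {a b : Fin k} {x : ℝ}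
    (hpq : ∀ i, p i = q i * Real.exp (x * pairSign a b i)) (ω : Fin h → Fin k) :
    ∏ t, p (ω t) = (∏ t, q (ω t)) * Real.exp (x * lead a b ω) := by
  simp_rw [hpq, Finset.prod_mul_distrib, ← Real.exp_sum, ← Finset.mul_sum]
  rfl

theorem winPr_sub_winPr {k h : ℕ} {p q : Fin k → ℝ} {a b : Fin k} {x : ℝ}
    (hq : ∀ i, q (Equiv.swap a b i) = q i)
    (hpq : ∀ i, p i = q i * Real.exp (x * pairSign a b i)) :
    winPr k h p a - winPr k h p b = ∑ ω : Fin h → Fin k, (∏ t, q (ω t)) *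
      ((winWeight ω a + winWeight ω b) * Real.sinh (x * |lead a b ω|)) := by
  have h1 : winPr k h p a - winPr k h p b = ∑ ω : Fin h → Fin k, (∏ t, q (ω t)) *
      (Real.exp (x * lead a b ω) * (winWeight ω a - winWeight ω b)) := by
    simp_rw [winPr_eq_sum, ← Finset.sum_sub_distrib, prod_tilt hpq]
    exact Finset.sum_congr rfl fun ω _ => by ring
  have h2 := sum_symm_mul_swapOn hq (fun _ => true) fun ω : Fin h → Fin k =>
    Real.exp (x * lead a b ω) * (winWeight ω a - winWeight ω b)
  rw [← h1] at h2
  simp only [lead_swapOn_true, winWeight_swapOn_true, Equiv.swap_apply_left,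
    Equiv.swap_apply_right] at h2
  have h3 : winPr k h p a - winPr k h p b =
      ((winPr k h p a - winPr k h p b) + (winPr k h p a - winPr k h p b)) / 2 := by ring
  rw [h3]
  nth_rewrite 1 [h1]
  rw [← h2, ← Finset.sum_add_distrib, Finset.sum_div]
  refine Finset.sum_congr rfl fun ω _ => ?_
  rcases lt_trichotomy (cnt ω a) (cnt ω b) with hlt | heq | hgt
  · have hD : |lead a b ω| = - lead a b ω := by
      rw [lead_eq]
      exact abs_of_neg (sub_neg.2 (by exact_mod_cast hlt))
    rw [winWeight_eq_zero_of_lt hlt, hD, Real.sinh_eq]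
    ring_nf
  · have hD : lead a b ω = 0 := by rw [lead_eq, heq, sub_self]
    rw [winWeight_eq_of_cnt_eq heq, hD]
    simp
  · have hD : |lead a b ω| = lead a b ω := by
      rw [lead_eq]
      exact abs_of_pos (sub_pos.2 (by exact_mod_cast hgt))
    rw [winWeight_eq_zero_of_lt hgt, hD, Real.sinh_eq]
    ring_nf

theorem half_min_mul_cosh_le_sinh {z : ℝ} (hz : 0 ≤ z) :
    Real.cosh z * (min 1 z / 2) ≤ Real.sinh z := by
  set y := min 1 z with hy
  have hy1 : y ≤ 1 := min_le_left _ _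
  have hyz : y ≤ z := min_le_right _ _
  have hy0 : 0 ≤ y := le_min zero_le_one hz
  have h1 : Real.exp z = Real.exp (2 * z) * Real.exp (-z) := by
    rw [← Real.exp_add]; ring_nf
  have h2 : 2 * z + 1 ≤ Real.exp (2 * z) := Real.add_one_le_exp _
  rw [Real.cosh_eq, Real.sinh_eq, h1]
  have h3 : (Real.exp (2 * z) + 1) * (y / 2) ≤ Real.exp (2 * z) - 1 := by
    nlinarith
  have h4 := mul_le_mul_of_nonneg_right h3 (Real.exp_pos (-z)).le
  linarith

/-- Averaging over all swaps of `a` and `b`, winning and a large lead are positively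
correlated. -/
theorem sum_swapOn_cosh_le_sum_sinh {k h : ℕ} {a b : Fin k} (hab : a ≠ b) {x m : ℝ}
    (hx : 0 ≤ x) (hm : 0 < m) (ω : Fin h → Fin k) (hmω : m ≤ cnt ω a + cnt ω b) :
    (min 1 (x * √(3 / 2 * m)) / 6) * ∑ ε : Fin h → Bool,
        (winWeight (swapOn a b ε ω) a + winWeight (swapOn a b ε ω) b) *
          Real.cosh (x * |lead a b (swapOn a b ε ω)|) ≤
      ∑ ε : Fin h → Bool,
        (winWeight (swapOn a b ε ω) a + winWeight (swapOn a b ε ω) b) *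
          Real.sinh (x * |lead a b (swapOn a b ε ω)|) := by
  set W : (Fin h → Bool) → ℝ := fun ε =>
    winWeight (swapOn a b ε ω) a + winWeight (swapOn a b ε ω) b with hW
  set L : (Fin h → Bool) → ℝ := fun ε => |lead a b (swapOn a b ε ω)| with hL
  have hW0 : ∀ ε, 0 ≤ W ε := fun ε => add_nonneg (winWeight_nonneg _ _) (winWeight_nonneg _ _)
  have hL0 : ∀ ε, 0 ≤ L ε := fun ε => abs_nonneg _
  have hmono : Monovary (fun ε => W ε * Real.cosh (x * L ε)) fun ε => min 1 (x * L ε) / 2 := by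
    intro ε ε' hlt
    have hlt' : L ε < L ε' := by
      by_contra! hle
      have : min 1 (x * L ε') ≤ min 1 (x * L ε) := by gcongr
      simp only at hlt
      linarith
    have hWle : W ε ≤ W ε' := by
      refine winWeight_add_mono hab (fun i hia hib => ?_) ?_ hlt'
      · rw [cnt_swapOn_of_ne hia hib, cnt_swapOn_of_ne hia hib]
      · rw [cnt_add_cnt_swapOn hab, cnt_add_cnt_swapOn hab]
    have hc : Real.cosh (x * L ε) ≤ Real.cosh (x * L ε') := by
      rw [Real.cosh_le_cosh, abs_of_nonneg (mul_nonneg hx (hL0 _)),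
        abs_of_nonneg (mul_nonneg hx (hL0 _))]
      gcongr
    exact mul_le_mul hWle hc (Real.cosh_pos _).le (hW0 _)
  have hcheb := hmono.sum_mul_sum_le_card_mul_sum
  have hg : 2 ^ h * (min 1 (x * √(3 / 2 * m)) / 6) ≤ ∑ ε, min 1 (x * L ε) / 2 := by
    have := le_sum_min_one_abs (fun t => pairSign a b (ω t)) hx hm
      (by rwa [sum_pairSign_sq hab])
    simp only [← lead_swapOn] at this
    rw [← Finset.sum_div]
    linarith
  have hcard : (Fintype.card (Fin h → Bool) : ℝ) = 2 ^ h := by simp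
  rw [hcard] at hcheb
  have hS0 : 0 ≤ ∑ ε, W ε * Real.cosh (x * L ε) :=
    Finset.sum_nonneg fun ε _ => mul_nonneg (hW0 ε) (Real.cosh_pos _).le
  have h2 : (0 : ℝ) < 2 ^ h := by positivity
  have hle : ∑ ε, W ε * Real.cosh (x * L ε) * (min 1 (x * L ε) / 2) ≤
      ∑ ε, W ε * Real.sinh (x * L ε) := by
    refine Finset.sum_le_sum fun ε _ => ?_
    rw [mul_assoc]
    exact mul_le_mul_of_nonneg_left
      (half_min_mul_cosh_le_sinh (mul_nonneg hx (hL0 ε))) (hW0 ε)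
  refine le_trans (le_of_mul_le_mul_left ?_ h2) hle
  calc 2 ^ h * ((min 1 (x * √(3 / 2 * m)) / 6) * ∑ ε, W ε * Real.cosh (x * L ε))
      = (∑ ε, W ε * Real.cosh (x * L ε)) * (2 ^ h * (min 1 (x * √(3 / 2 * m)) / 6)) := by ring
    _ ≤ (∑ ε, W ε * Real.cosh (x * L ε)) * ∑ ε, min 1 (x * L ε) / 2 := by gcongr
    _ ≤ _ := hcheb

/-- The bias between the winning probabilities dominates the probability that one of the two
opinions wins with a joint count of at least `m`. -/
theorem le_winPr_sub_winPr {k h : ℕ} {p q : Fin k → ℝ} {a b : Fin k} {x m : ℝ}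
    (hab : a ≠ b) (hq0 : ∀ i, 0 ≤ q i) (hq : ∀ i, q (Equiv.swap a b i) = q i)
    (hpq : ∀ i, p i = q i * Real.exp (x * pairSign a b i)) (hx : 0 ≤ x) (hm : 0 < m) :
    (min 1 (x * √(3 / 2 * m)) / 6) * ∑ ω : Fin h → Fin k, (∏ t, p (ω t)) *
        ((winWeight ω a + winWeight ω b) * if m ≤ cnt ω a + cnt ω b then 1 else 0) ≤
      winPr k h p a - winPr k h p b := by
  set I : (Fin h → Fin k) → ℝ := fun ω => if m ≤ cnt ω a + cnt ω b then 1 else 0 with hI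
  have hIs : ∀ ε ω, I (swapOn a b ε ω) = I ω := by
    intro ε ω
    have := cnt_add_cnt_swapOn hab ε ω
    have h' : (cnt (swapOn a b ε ω) a + cnt (swapOn a b ε ω) b : ℝ) = cnt ω a + cnt ω b := by
      exact_mod_cast this
    simp only [hI, h']
  set S : ℝ := ∑ ω : Fin h → Fin k, (∏ t, p (ω t)) * ((winWeight ω a + winWeight ω b) * I ω)
  have hS : S = ∑ ω : Fin h → Fin k, (∏ t, q (ω t)) *
      ((winWeight ω a + winWeight ω b) * Real.cosh (x * |lead a b ω|) * I ω) := by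
    have h1 : S = ∑ ω : Fin h → Fin k, (∏ t, q (ω t)) * (Real.exp (x * lead a b ω) *
        ((winWeight ω a + winWeight ω b) * I ω)) := by
      simp_rw [S, prod_tilt hpq, mul_assoc]
    have h2 := sum_symm_mul_swapOn hq (fun _ => true) fun ω : Fin h → Fin k =>
      Real.exp (x * lead a b ω) * ((winWeight ω a + winWeight ω b) * I ω)
    rw [← h1] at h2
    simp only [lead_swapOn_true, winWeight_swapOn_true, Equiv.swap_apply_left,
      Equiv.swap_apply_right, hIs] at h2
    have h3 : S = (S + S) / 2 := by ring
    rw [h3]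
    nth_rewrite 1 [h1]
    rw [← h2, ← Finset.sum_add_distrib, Finset.sum_div]
    refine Finset.sum_congr rfl fun ω _ => ?_
    have hc : Real.cosh (x * |lead a b ω|) = Real.cosh (x * lead a b ω) := by
      rw [← Real.cosh_abs, abs_mul, abs_abs, ← abs_mul, Real.cosh_abs]
    rw [hc, Real.cosh_eq]
    ring_nf
  rw [hS, winPr_sub_winPr hq hpq]
  have h2 : (0 : ℝ) < 2 ^ h := by positivity
  refine le_of_mul_le_mul_left ?_ h2
  rw [mul_left_comm, ← sum_symm_mul_average hq, ← sum_symm_mul_average hq, Finset.mul_sum]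
  refine Finset.sum_le_sum fun ω _ => ?_
  rw [mul_left_comm]
  refine mul_le_mul_of_nonneg_left ?_ (Finset.prod_nonneg fun t _ => hq0 _)
  simp only [hIs, ← Finset.sum_mul]
  by_cases hω : m ≤ cnt ω a + cnt ω b
  · simpa [hI, hω] using sum_swapOn_cosh_le_sum_sinh hab hx hm ω hω
  · simp only [hI, hω, if_false, mul_zero]
    exact Finset.sum_nonneg fun ε _ => mul_nonneg
      (add_nonneg (winWeight_nonneg _ _) (winWeight_nonneg _ _))
      (Real.sinh_nonneg_iff.2 (mul_nonneg hx (abs_nonneg _)))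

/-- Two positive probabilities are opposite exponential tilts of their geometric mean. -/
theorem exists_symm_tilt {k : ℕ} {p : Fin k → ℝ} {a b : Fin k} (hab : a ≠ b)
    (hp : ∀ i, 0 ≤ p i) (hb : 0 < p b) (hba : p b ≤ p a) :
    ∃ q : Fin k → ℝ, (∀ i, 0 ≤ q i) ∧ (∀ i, q (Equiv.swap a b i) = q i) ∧
      ∀ i, p i = q i * Real.exp (Real.log (p a / p b) / 2 * pairSign a b i) := by
  have ha : 0 < p a := hb.trans_le hba
  have hsq : Real.exp (Real.log (p a / p b) / 2) = √(p a / p b) := by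
    rw [← Real.log_sqrt (by positivity), Real.exp_log (by positivity)]
  refine ⟨fun i => if i = a ∨ i = b then √(p a * p b) else p i, fun i => ?_, fun i => ?_,
    fun i => ?_⟩
  · dsimp only
    split_ifs
    exacts [Real.sqrt_nonneg _, hp i]
  · rcases eq_or_ne i a with rfl | hia
    · simp
    · rcases eq_or_ne i b with rfl | hib
      · simp
      · simp [Equiv.swap_apply_of_ne_of_ne hia hib]
  · rcases eq_or_ne i a with rfl | hia
    · simp only [true_or, if_true, pairSign, hab, if_false, sub_zero, mul_one, hsq]
      rw [← Real.sqrt_mul (by positivity), show p i * p b * (p i / p b) = p i ^ 2 by field_simp,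
        Real.sqrt_sq ha.le]
    · rcases eq_or_ne i b with rfl | hib
      · simp only [or_true, if_true, pairSign, hia, if_false, zero_sub, mul_neg, mul_one,
          Real.exp_neg, hsq]
        rw [← Real.sqrt_inv, ← Real.sqrt_mul (by positivity),
          show p a * p i * (p a / p i)⁻¹ = p i ^ 2 by field_simp, Real.sqrt_sq hb.le]
      · simp [pairSign, hia, hib]

theorem multiPr_compl {k h : ℕ} {p : Fin k → ℝ} (hp1 : ∑ i, p i = 1)
    (A : Set (Fin h → Fin k)) : multiPr k h p A = 1 - multiPr k h p Aᶜ := by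
  rw [← sum_prod_eq_one (h := h) hp1, multiPr, multiPr, ← Finset.sum_sub_distrib]
  refine Finset.sum_congr rfl fun ω _ => ?_
  by_cases hω : ω ∈ A <;> simp [hω]

/-- The exponential form of the Chernoff bound. -/
theorem multiPr_le_exp {k h : ℕ} {p : Fin k → ℝ} (hp : ∀ i, 0 ≤ p i) (hp1 : ∑ i, p i = 1)
    (g : Fin k → ℝ) {c u : ℝ} (A : Set (Fin h → Fin k)) (hA : ∀ ω ∈ A, c ≤ ∑ t, g (ω t))
    (hu : ∑ i, p i * (Real.exp (g i) - 1) ≤ u) : multiPr k h p A ≤ Real.exp (h * u - c) := by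
  have h1 := multiPr_le_pow hp (fun i => Real.exp (g i)) (fun i => (Real.exp_pos _).le)
    (c := Real.exp c) A (fun ω hω => by
      rw [← Real.exp_sum]
      exact Real.exp_le_exp.2 (hA ω hω))
  have h2 : ∑ i, p i * Real.exp (g i) ≤ Real.exp u := by
    simp only [mul_sub, mul_one, Finset.sum_sub_distrib, hp1] at hu
    linarith [Real.add_one_le_exp u]
  have h3 : (∑ i, p i * Real.exp (g i)) ^ h ≤ Real.exp (h * u) := by
    rw [Real.exp_nat_mul]
    exact pow_le_pow_left₀
      (Finset.sum_nonneg fun i _ => mul_nonneg (hp i) (Real.exp_pos _).le) h2 h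
  rw [Real.exp_sub, le_div_iff₀ (Real.exp_pos c), mul_comm]
  exact h1.trans h3

theorem sum_mul_exp_pairSign_sub_one {k : ℕ} (p : Fin k → ℝ) {a b : Fin k} (hab : a ≠ b)
    (x : ℝ) : ∑ i, p i * (Real.exp (x * pairSign a b i) - 1) =
      p a * (Real.exp x - 1) + p b * (Real.exp (-x) - 1) := by
  rw [← Finset.sum_subset (Finset.subset_univ {a, b}), Finset.sum_pair hab]
  · simp [pairSign, hab, hab.symm]
  · intro i _ hi
    simp only [Finset.mem_insert, Finset.mem_singleton, not_or] at hi
    simp [pairSign, hi]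

theorem multiPr_cnt_lt_le {k h : ℕ} {p : Fin k → ℝ} (hp : ∀ i, 0 ≤ p i) (hp1 : ∑ i, p i = 1)
    (a : Fin k) (A : Set (Fin h → Fin k)) (hA : ∀ ω ∈ A, (cnt ω a : ℝ) ≤ h * p a / 2) :
    multiPr k h p A ≤ Real.exp (-(h * p a / 12)) := by
  have hlog := Real.log_two_lt_d9
  have hlog0 : 0 < Real.log 2 := Real.log_pos one_lt_two
  refine (multiPr_le_exp hp hp1 (fun i => -Real.log 2 * if i = a then 1 else 0)
    (c := -Real.log 2 * (h * p a / 2)) (u := -(p a / 2)) A (fun ω hω => ?_) ?_).trans ?_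
  · rw [← Finset.mul_sum, sum_ite_eq_cnt]
    exact mul_le_mul_of_nonpos_left (hA ω hω) (by linarith)
  · rw [Finset.sum_eq_single a]
    · simp only [if_true, mul_one, Real.exp_neg, Real.exp_log two_pos]
      linarith
    · intro i _ hi
      simp [hi]
    · simp
  · refine Real.exp_le_exp.2 ?_
    have : 0 ≤ h * p a := mul_nonneg (Nat.cast_nonneg _) (hp a)
    nlinarith

theorem multiPr_cnt_le_cnt {k h : ℕ} {p : Fin k → ℝ} (hp : ∀ i, 0 ≤ p i)
    (hp1 : ∑ i, p i = 1) {a i : Fin k} (hia : i ≠ a) (hi : p i ≤ p a / 2) :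
    multiPr k h p {ω | cnt ω a ≤ cnt ω i} ≤ Real.exp (-(h * p a / 12)) := by
  have hlog0 : 0 ≤ Real.log (4 / 3) := Real.log_nonneg (by norm_num)
  refine (multiPr_le_exp hp hp1 (fun l => Real.log (4 / 3) * pairSign i a l)
    (c := 0) (u := -(p a / 12)) _ (fun ω hω => ?_) ?_).trans (le_of_eq (by ring_nf))
  · rw [← Finset.mul_sum]
    change 0 ≤ _ * lead i a ω
    rw [lead_eq]
    have hω' : (cnt ω a : ℝ) ≤ cnt ω i := by exact_mod_cast hω
    exact mul_nonneg hlog0 (sub_nonneg.2 hω')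
  · rw [sum_mul_exp_pairSign_sub_one p hia, Real.exp_neg, Real.exp_log (by norm_num)]
    norm_num
    linarith

theorem winPr_le_multiPr {k h : ℕ} {p : Fin k → ℝ} (hp : ∀ i, 0 ≤ p i) (a i : Fin k) :
    winPr k h p i ≤ multiPr k h p {ω | cnt ω a ≤ cnt ω i} := by
  rw [winPr_eq_sum, multiPr]
  refine Finset.sum_le_sum fun ω _ => ?_
  have hP : 0 ≤ ∏ t, p (ω t) := Finset.prod_nonneg fun t _ => hp _
  by_cases hω : cnt ω a ≤ cnt ω i
  · rw [Set.indicator_of_mem (by exact hω)]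
    exact mul_le_of_le_one_right hP (winWeight_le_one ω i)
  · rw [winWeight_eq_zero_of_lt (not_le.1 hω), mul_zero]
    exact Set.indicator_nonneg (fun ω _ => Finset.prod_nonneg fun t _ => hp _) ω

theorem winPr_mono {k h : ℕ} {p : Fin k → ℝ} (hp : ∀ i, 0 ≤ p i) {a b : Fin k}
    (hb : 0 < p b) (hba : p b ≤ p a) : winPr k h p b ≤ winPr k h p a := by
  rcases eq_or_ne a b with rfl | hab
  · exact le_rfl
  obtain ⟨q, hq0, hq, hpq⟩ := exists_symm_tilt hab hp hb hba
  rw [← sub_nonneg, winPr_sub_winPr hq hpq]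
  have hx : 0 ≤ Real.log (p a / p b) / 2 :=
    div_nonneg (Real.log_nonneg ((one_le_div hb).2 hba)) two_pos.le
  exact Finset.sum_nonneg fun ω _ => mul_nonneg (Finset.prod_nonneg fun t _ => hq0 _)
    (mul_nonneg (add_nonneg (winWeight_nonneg _ _) (winWeight_nonneg _ _))
      (Real.sinh_nonneg_iff.2 (mul_nonneg hx (abs_nonneg _))))

/-- The most likely opinion wins with probability at least a quarter of its share. -/
theorem quarter_le_winPr {k h : ℕ} {p : Fin k → ℝ} (hp : ∀ i, 0 ≤ p i) (hp1 : ∑ i, p i = 1)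
    {a : Fin k} (ha : 0 < p a) (hmax : ∀ i, p i ≤ p a)
    (htail : k * Real.exp (-(h * p a / 12)) ≤ 1 / 2) : p a / 4 ≤ winPr k h p a := by
  set N := Finset.univ.filter fun i => p a / 2 < p i
  have hN : (N.card : ℝ) * (p a / 2) ≤ 1 := by
    rw [← hp1, ← nsmul_eq_mul, ← Finset.sum_const]
    exact (Finset.sum_le_sum fun i hi => (Finset.mem_filter.1 hi).2.le).trans
      (Finset.sum_le_sum_of_subset_of_nonneg (Finset.subset_univ _) fun i _ _ => hp i)
  have hpt : ∀ i, winPr k h p i ≤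
      (if p a / 2 < p i then winPr k h p a else 0) + Real.exp (-(h * p a / 12)) := by
    intro i
    split_ifs with hi
    · exact (winPr_mono hp (by linarith) (hmax i)).trans
        (le_add_of_nonneg_right (Real.exp_pos _).le)
    · rw [zero_add]
      refine (winPr_le_multiPr hp a i).trans (multiPr_cnt_le_cnt hp hp1 ?_ (not_lt.1 hi))
      rintro rfl
      linarith
  have hsum := Finset.sum_le_sum fun i (_ : i ∈ Finset.univ) => hpt i
  rw [sum_winPr a.pos hp1, Finset.sum_add_distrib, ← Finset.sum_filter, Finset.sum_const,
    Finset.sum_const, nsmul_eq_mul, nsmul_eq_mul, Finset.card_univ, Fintype.card_fin] at hsum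
  have h1 : 1 / 2 ≤ (N.card : ℝ) * winPr k h p a := by linarith
  have h2 := mul_le_mul_of_nonneg_right h1 (half_pos ha).le
  have h3 := mul_le_mul_of_nonneg_right hN (winPr_nonneg (h := h) hp a)
  nlinarith

theorem winPr_add_sub_tail_le {k h : ℕ} {p : Fin k → ℝ} (hp : ∀ i, 0 ≤ p i)
    (hp1 : ∑ i, p i = 1) {a b : Fin k} (hab : a ≠ b) :
    winPr k h p a + winPr k h p b - Real.exp (-(h * p a / 12)) ≤
      ∑ ω : Fin h → Fin k, (∏ t, p (ω t)) * ((winWeight ω a + winWeight ω b) *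
        if h * p a / 2 ≤ (cnt ω a + cnt ω b : ℝ) then 1 else 0) := by
  have h1 := multiPr_cnt_lt_le hp hp1 a {ω : Fin h → Fin k | ¬ h * p a / 2 ≤
    (cnt ω a + cnt ω b : ℝ)} (fun ω hω => by
      have h2 := not_le.1 hω
      have h3 : (0 : ℝ) ≤ cnt ω b := Nat.cast_nonneg _
      linarith)
  rw [sub_le_iff_le_add]
  refine le_trans ?_ (add_le_add_right h1 _)
  rw [winPr_eq_sum, winPr_eq_sum, multiPr, ← Finset.sum_add_distrib, ← Finset.sum_add_distrib]
  refine Finset.sum_le_sum fun ω _ => ?_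
  have hP : 0 ≤ ∏ t, p (ω t) := Finset.prod_nonneg fun t _ => hp _
  rw [← mul_add]
  by_cases hω : h * p a / 2 ≤ (cnt ω a + cnt ω b : ℝ)
  · simp [hω]
  · rw [Set.indicator_of_mem (by exact hω), if_neg hω, mul_zero, mul_zero, zero_add]
    exact mul_le_of_le_one_right hP (winWeight_add_le_one hab ω)

/-- One round multiplies the bias by the order of the square root of `h * p a`. -/
theorem bias_le_winPr_sub_winPr {k h : ℕ} {p : Fin k → ℝ} (hp : ∀ i, 0 ≤ p i)
    (hp1 : ∑ i, p i = 1) {a b : Fin k} (hab : a ≠ b) (ha : 0 < p a) (hb : 0 < p b)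
    (hba : p b ≤ p a) (hh : 0 < h) (hδ : (p a - p b) * √(h * p a) ≤ 2 * p a)
    (htail : Real.exp (-(h * p a / 12)) ≤ (winPr k h p a + winPr k h p b) / 2) :
    (p a - p b) * √(h * p a) / p a / 30 * (winPr k h p a + winPr k h p b) ≤
      winPr k h p a - winPr k h p b := by
  obtain ⟨q, hq0, hq, hpq⟩ := exists_symm_tilt hab hp hb hba
  set x := Real.log (p a / p b) / 2 with hxdef
  set T := √(h * p a) with hT
  have hT0 : 0 ≤ T := Real.sqrt_nonneg _
  have hhp : (0 : ℝ) < h * p a := by positivity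
  have hx : (p a - p b) / p a / 2 ≤ x := by
    have h1 := Real.one_sub_inv_le_log_of_pos (x := p a / p b) (by positivity)
    rw [inv_div, one_sub_div ha.ne'] at h1
    rw [hxdef]
    linarith
  have hδ0 : 0 ≤ (p a - p b) / p a := div_nonneg (sub_nonneg.2 hba) ha.le
  have hx0 : 0 ≤ x := le_trans (by positivity) hx
  have hmain := le_winPr_sub_winPr (h := h) (m := h * p a / 2) hab hq0 hq hpq hx0 (by positivity)
  have hsum := winPr_add_sub_tail_le (h := h) hp hp1 hab
  have hroot : 4 / 5 * T ≤ √(3 / 2 * (h * p a / 2)) := by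
    refine Real.le_sqrt_of_sq_le ?_
    rw [mul_pow, hT, Real.sq_sqrt hhp.le]
    linarith
  have hα : (p a - p b) * T / p a ≤ 2 := (div_le_iff₀ ha).2 hδ
  have hmin : 2 / 5 * ((p a - p b) * T / p a) ≤ min 1 (x * √(3 / 2 * (h * p a / 2))) := by
    refine le_min (by linarith) ?_
    calc 2 / 5 * ((p a - p b) * T / p a) = (p a - p b) / p a / 2 * (4 / 5 * T) := by ring
      _ ≤ _ := mul_le_mul hx hroot (by positivity) hx0
  have hα0 : 0 ≤ (p a - p b) * T / p a := by
    rw [mul_div_right_comm]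
    exact mul_nonneg hδ0 hT0
  have hw : 0 ≤ winPr k h p a + winPr k h p b :=
    add_nonneg (winPr_nonneg hp a) (winPr_nonneg hp b)
  refine le_trans ?_ hmain
  calc (p a - p b) * T / p a / 30 * (winPr k h p a + winPr k h p b)
      = 2 / 5 * ((p a - p b) * T / p a) / 6 * ((winPr k h p a + winPr k h p b) / 2) := by ring
    _ ≤ _ := mul_le_mul (by linarith) (by linarith) (by positivity) (by positivity)

/-- Concentration of the difference of two coordinates of a multinomial vector. -/
theorem multiPr_lead_le {k n : ℕ} {w : Fin k → ℝ} (hw : ∀ i, 0 ≤ w i) (hw1 : ∑ i, w i = 1)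
    {a b : Fin k} (hab : a ≠ b) (hba : w b ≤ w a) (ha : 0 < w a)
    (A : Set (Fin n → Fin k)) (hA : ∀ σ ∈ A, lead a b σ ≤ n * ((w a - w b) / 2)) :
    multiPr k n w A ≤ Real.exp (-(n * ((w a - w b) ^ 2 / (16 * (w a + w b))))) := by
  set Δ := w a - w b with hΔ
  have hs : 0 < w a + w b := add_pos_of_pos_of_nonneg ha (hw b)
  set s := w a + w b with hsdef
  have hΔ0 : 0 ≤ Δ := sub_nonneg.2 hba
  have hΔs : Δ ≤ s := by linarith [hw b]
  set y := Δ / (4 * s) with hy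
  have hy0 : 0 ≤ y := by positivity
  have hy1 : y ≤ 1 := by
    rw [hy, div_le_one (by positivity)]
    linarith
  refine (multiPr_le_exp hw hw1 (fun i => -y * pairSign a b i)
    (c := -y * (n * (Δ / 2))) (u := -y * Δ + y ^ 2 * s) A (fun σ hσ => ?_) ?_).trans ?_
  · rw [← Finset.mul_sum]
    exact mul_le_mul_of_nonpos_left (hA σ hσ) (by linarith)
  · rw [sum_mul_exp_pairSign_sub_one w hab, neg_neg]
    have h1 := abs_le.1 (Real.abs_exp_sub_one_sub_id_le (x := y) (by rwa [abs_of_nonneg hy0]))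
    have h2 := abs_le.1 (Real.abs_exp_sub_one_sub_id_le (x := -y)
      (by rwa [abs_neg, abs_of_nonneg hy0]))
    have h3 := mul_le_mul_of_nonneg_left h1.2 (hw b)
    have h4 := mul_le_mul_of_nonneg_left h2.2 (hw a)
    rw [hsdef, hΔ]
    linarith
  · refine Real.exp_le_exp.2 (le_of_eq ?_)
    rw [hy]
    field_simp
    ring

/-- one-round multiplicative growth of the bias.  The next-round
configuration `conf'` of the `h`-majority process on `n` nodes is multinomial
with parameters `n` and the winning-probability vector `winPr k h p`; it is
modeled by the `n` node samples `σ : Fin n → Fin k`, so `conf'(i) = cnt σ i`.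
With probability at least `1 - 1/n⁴`, `conf'(1)/n - conf'(j)/n ≥ e·(p_1 - p_j)`. -/
theorem one_round_bias_amplification :
    ∃ C4 C7 C8 : ℝ, 0 < C4 ∧ 0 < C7 ∧ 0 < C8 ∧
      ∃ n0 : ℕ, ∀ (n k h : ℕ), n0 ≤ n → ∀ (hk : 2 ≤ k), 1 ≤ h → k ≤ n →
        ∀ p : Fin k → ℝ, (∀ i, 0 ≤ p i) → ∑ i, p i = 1 →
          (∀ i j : Fin k, i ≤ j → p j ≤ p i) →
          C7 * Real.log n / n ≤ p (o₁ k hk) →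
          C4 * Real.log n ≤ (h : ℝ) * p (o₁ k hk) →
          ∀ j : Fin k, j ≠ o₁ k hk →
            C8 * Real.sqrt (p (o₁ k hk) / n) ≤ p (o₁ k hk) - p j →
            p (o₁ k hk) - p j ≤ Real.sqrt (2 * (p (o₁ k hk) + p (o₂ k hk)) / h) →
            1 - 1 / (n : ℝ) ^ 4 ≤
              multiPr k n (winPr k h p)
                {σ | Real.exp 1 * (p (o₁ k hk) - p j) ≤
                  (cnt σ (o₁ k hk) : ℝ) / n - (cnt σ j : ℝ) / n} := by
  refine ⟨10 ^ 6, 1, 1, by norm_num, one_pos, one_pos, 3, ?_⟩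
  intro n k h hn hk hh hkn p hp hp1 hmono hC7 hC4 j hj hC8 hδ
  set a := o₁ k hk
  have hmax : ∀ i, p i ≤ p a := fun i => hmono a i (Nat.zero_le _)
  have hn3 : (3 : ℝ) ≤ n := by exact_mod_cast hn
  have hn0 : (0 : ℝ) < n := by linarith
  have hh0 : (0 : ℝ) < h := by exact_mod_cast hh
  have hL : 1 ≤ Real.log n := by
    rw [Real.le_log_iff_exp_le hn0]
    linarith [Real.exp_one_lt_d9]
  have hpn : 1 / (n : ℝ) ≤ p a := by
    refine le_trans ?_ hC7
    rw [one_mul]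
    gcongr
  have ha : 0 < p a := lt_of_lt_of_le (by positivity) hpn
  set T := √(h * p a) with hT
  have hT2 : T ^ 2 = h * p a := Real.sq_sqrt (by positivity)
  have hT1000 : 1000 ≤ T := Real.le_sqrt_of_sq_le (by linarith)
  have hδ0 : 0 ≤ p a - p j := sub_nonneg.2 (hmax j)
  have hδT : (p a - p j) * T ≤ 2 * p a := by
    have h1 : √(2 * (p a + p (o₂ k hk)) / h) * T ≤ 2 * p a := by
      rw [hT, ← Real.sqrt_mul (div_nonneg (by linarith [hp (o₂ k hk)]) hh0.le)]
      refine Real.sqrt_le_iff.2 ⟨by positivity, ?_⟩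
      have h2 : 2 * (p a + p (o₂ k hk)) / h * (h * p a) = 2 * (p a + p (o₂ k hk)) * p a := by
        field_simp
      rw [h2]
      nlinarith [hmax (o₂ k hk)]
    exact (mul_le_mul_of_nonneg_right hδ (by linarith)).trans h1
  have hb : 0 < p j := by nlinarith
  have hpow : ∀ m : ℕ, Real.exp (-(m * Real.log n)) = 1 / (n : ℝ) ^ m := by
    intro m
    rw [Real.exp_neg, Real.exp_nat_mul, Real.exp_log hn0, one_div]
  have htail : Real.exp (-(h * p a / 12)) ≤ 1 / (n : ℝ) ^ 3 := by
    rw [← hpow]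
    refine Real.exp_le_exp.2 ?_
    push_cast
    linarith
  have hkn' : (k : ℝ) ≤ n := by exact_mod_cast hkn
  have hn9 : 1 / (n : ℝ) ^ 3 ≤ 1 / n / 9 := by
    rw [div_div]
    refine one_div_le_one_div_of_le (by positivity) ?_
    have : (3 : ℝ) ^ 2 ≤ (n : ℝ) ^ 2 := by gcongr
    nlinarith
  have hquarter : p a / 4 ≤ winPr k h p a := by
    refine quarter_le_winPr hp hp1 ha hmax ?_
    calc (k : ℝ) * Real.exp (-(h * p a / 12)) ≤ n * (1 / n / 9) := by
          gcongr
          exact htail.trans hn9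
      _ ≤ 1 / 2 := by
          field_simp
          norm_num
  have hwj : 0 ≤ winPr k h p j := winPr_nonneg hp j
  have hbias := bias_le_winPr_sub_winPr hp hp1 hj.symm ha hb (hmax j) hh hδT (by linarith)
  rw [← hT] at hbias
  set s := winPr k h p a + winPr k h p j with hs
  have hspa : p a / 4 ≤ s := by linarith
  have hs0 : 0 < s := by linarith
  have hgrow : Real.exp 1 * (p a - p j) ≤ (winPr k h p a - winPr k h p j) / 2 := by
    have h1 : (p a - p j) * T / p a / 30 * (p a / 4) ≤
        (p a - p j) * T / p a / 30 * s := by gcongr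
    have h2 : (p a - p j) * T / p a / 30 * (p a / 4) = (p a - p j) * T / 120 := by
      field_simp
      ring
    nlinarith [Real.exp_one_lt_d9]
  rw [multiPr_compl (sum_winPr (by omega) hp1)]
  refine sub_le_sub_left ((multiPr_lead_le (winPr_nonneg hp) (sum_winPr (by omega) hp1) hj.symm
    (winPr_mono hp hb (hmax j)) (by linarith) _ fun σ hσ => ?_).trans ?_) 1
  · have h1 := not_le.1 (Set.notMem_ofPred_iff.1 hσ)
    rw [← sub_div, ← lead_eq, div_lt_iff₀ hn0] at h1
    have h2 := mul_le_mul_of_nonneg_right hgrow hn0.le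
    linarith
  · rw [← hpow]
    refine Real.exp_le_exp.2 (neg_le_neg ?_)
    rw [← hs]
    have h1 : p a ≤ (p a - p j) ^ 2 * n := by
      rw [one_mul] at hC8
      have h2 := pow_le_pow_left₀ (Real.sqrt_nonneg _) hC8 2
      rwa [Real.sq_sqrt (by positivity), div_le_iff₀ hn0] at h2
    have h2 : ((p a - p j) * T / p a / 30 * s) ^ 2 ≤ (winPr k h p a - winPr k h p j) ^ 2 := by
      gcongr
    calc ((4 : ℕ) : ℝ) * Real.log n ≤ h * p a / 57600 := by
          push_cast
          linarith
      _ ≤ h * ((p a - p j) ^ 2 * n) / 57600 := by gcongr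
      _ = n * ((p a - p j) ^ 2 * T ^ 2 / p a ^ 2 / 900 * (p a / 4) / 16) := by
          rw [hT2]
          field_simp
          ring
      _ ≤ n * ((p a - p j) ^ 2 * T ^ 2 / p a ^ 2 / 900 * s / 16) := by gcongr
      _ = n * (((p a - p j) * T / p a / 30 * s) ^ 2 / (16 * s)) := by
          field_simp
          norm_num
      _ ≤ _ := by gcongr
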